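/- arXiv:0801.1999 — 3 statements merged into one kernel-verified Lean document; each statement's English description precedes it below -/
import Mathlib

section
/- Let $a\in\mathbb{R}$, $g\in L^\infty(a,\infty)$, and let $K:(a,\infty)\times(a,\infty)\to\mathbb{C}$ be measurable with $\mu:=\int_a^\infty \sup_{a<x<s}|K(x,s)|\,ds<\infty$. Then the Volterra integral equation $f(x)=g(x)+\int_x^\infty K(x,s)f(s)\,ds$ has a unique bounded solution on $(a,\infty)$, given by the convergent series $f(x)=g(x)+\sum_{n=1}^\infty \int_a^\infty\cdots\int_a^\infty \prod_{i=1}^n \chi_{[x_{i-1}<x_i]}K(x_{i-1},x_i)\,g(x_n)\,dx_n\cdots dx_1$ (with $x_0:=x$), and it satisfies $\|f\|_{L^\infty(a,\infty)}\le e^{\mu}\|g\|_{L^\infty(a,\infty)}$. -/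
open MeasureTheory Set

/-- `kernelSup a K s = sup_{a < x < s} ‖K x s‖`. -/
noncomputable def kernelSup (a : ℝ) (K : ℝ → ℝ → ℂ) (s : ℝ) : ℝ :=
  sSup ((fun x => ‖K x s‖) '' Set.Ioo a s)

/-- The `n`-fold iterate of the Volterra series, with `x₀ := x`:
`∫_a^∞ ⋯ ∫_a^∞ ∏ χ_{x_{i-1} < x_i} K(x_{i-1}, x_i) g(x_n) dx_n ⋯ dx_1`. -/
noncomputable def volterraIter (a : ℝ) (K : ℝ → ℝ → ℂ) (g : ℝ → ℂ) (n : ℕ) (x : ℝ) : ℂ :=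
  ∫ y : Fin n → ℝ,
    (∏ i : Fin n,
      if a < (Fin.cons x y : Fin (n + 1) → ℝ) i.succ ∧
          (Fin.cons x y : Fin (n + 1) → ℝ) i.castSucc < (Fin.cons x y : Fin (n + 1) → ℝ) i.succ
        then K ((Fin.cons x y : Fin (n + 1) → ℝ) i.castSucc) ((Fin.cons x y : Fin (n + 1) → ℝ) i.succ) else 0)
      * g ((Fin.cons x y : Fin (n + 1) → ℝ) (Fin.last n))

open Filter Topology
open scoped ENNReal

/-- Power identity for tails of an atomless finite measure. -/
lemma tail_pow (m : Measure ℝ) [IsFiniteMeasure m] [NullSingletonClass m] (n : ℕ) : ∀ x : ℝ,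
    m (Ioi x) ^ (n + 1) = ((n + 1 : ℕ) : ℝ≥0∞) * ∫⁻ s in Ioi x, m (Ioi s) ^ n ∂m := by
  have hT : Measurable fun s : ℝ => m (Ioi s) :=
    Antitone.measurable fun s t h => measure_mono (Ioi_subset_Ioi h)
  induction n with
  | zero => intro x; simp
  | succ n ih =>
    intro x
    have h1 : ∀ s ∈ Ioi x, m (Ioi x) = m (Ioi s) + ∫⁻ t in Ioi x, (if t < s then 1 else 0) ∂m := by
      intro s hs
      have e1 : ∫⁻ t in Ioi x, (if t < s then (1 : ℝ≥0∞) else 0) ∂m = m (Ioo x s) := by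
        have : (fun t : ℝ => if t < s then (1 : ℝ≥0∞) else 0) = (Iio s).indicator 1 := by
          ext t; simp [indicator]
        rw [this, lintegral_indicator_one measurableSet_Iio, Measure.restrict_apply measurableSet_Iio]
        congr 1; ext t; simp [and_comm]
      rw [e1, measure_congr (Ioo_ae_eq_Ioc (μ := m)), add_comm, ← measure_union _ measurableSet_Ioi,
        Ioc_union_Ioi_eq_Ioi (le_of_lt hs)]
      exact Set.disjoint_left.2 fun t ht ht' => absurd ht.2 (not_le.2 ht')
    have h2 : m (Ioi x) ^ (n + 2) =
        ((n + 1 : ℕ) : ℝ≥0∞) * ∫⁻ s in Ioi x, m (Ioi s) ^ n * m (Ioi x) ∂m := by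
      rw [lintegral_mul_const _ (hT.pow_const n), ← mul_assoc, ← ih x]; ring
    have h3 : ∫⁻ s in Ioi x, m (Ioi s) ^ n * m (Ioi x) ∂m
        = ∫⁻ s in Ioi x, m (Ioi s) ^ (n + 1) ∂m +
          ∫⁻ s in Ioi x, ∫⁻ t in Ioi x, m (Ioi s) ^ n * (if t < s then 1 else 0) ∂m ∂m := by
      rw [← lintegral_add_left (hT.pow_const (n + 1))]
      refine setLIntegral_congr_fun measurableSet_Ioi fun s hs => ?_
      rw [lintegral_const_mul _ (Measurable.ite measurableSet_Iio measurable_const measurable_const),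
        pow_succ, ← mul_add, ← h1 s hs]
    have h4 : ∫⁻ s in Ioi x, ∫⁻ t in Ioi x, m (Ioi s) ^ n * (if t < s then 1 else 0) ∂m ∂m
        = ∫⁻ t in Ioi x, ∫⁻ s in Ioi t, m (Ioi s) ^ n ∂m ∂m := by
      rw [lintegral_lintegral_swap]
      · refine setLIntegral_congr_fun measurableSet_Ioi fun t ht => ?_
        have : (fun s => m (Ioi s) ^ n * (if t < s then (1 : ℝ≥0∞) else 0))
            = (Ioi t).indicator fun s => m (Ioi s) ^ n := by
          ext s; simp [indicator]
        rw [this, lintegral_indicator measurableSet_Ioi, Measure.restrict_restrict measurableSet_Ioi,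
          inter_eq_left.2 (Ioi_subset_Ioi (le_of_lt ht))]
      · apply Measurable.aemeasurable
        exact ((hT.pow_const n).comp measurable_fst).mul
          (Measurable.ite (measurableSet_lt measurable_snd measurable_fst) measurable_const
            measurable_const)
    have h5 : ((n + 1 : ℕ) : ℝ≥0∞) * ∫⁻ t in Ioi x, ∫⁻ s in Ioi t, m (Ioi s) ^ n ∂m ∂m
        = ∫⁻ s in Ioi x, m (Ioi s) ^ (n + 1) ∂m := by
      rw [← lintegral_const_mul' _ _ (ENNReal.natCast_ne_top _)]
      exact lintegral_congr fun t => (ih t).symm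
    rw [h2, h3, h4, mul_add, h5]
    push_cast; ring

/-- The dominating measure `kernelSup ds` on `(a, ∞)`. -/
noncomputable def domMeas (a : ℝ) (K : ℝ → ℝ → ℂ) : Measure ℝ :=
  (volume.restrict (Ioi a)).withDensity fun s => ENNReal.ofReal (kernelSup a K s)

lemma kernelSup_nonneg (a : ℝ) (K : ℝ → ℝ → ℂ) (s : ℝ) : 0 ≤ kernelSup a K s := by
  apply Real.sSup_nonneg
  rintro _ ⟨x, _, rfl⟩
  exact norm_nonneg _

lemma domMeas_univ (a : ℝ) (K : ℝ → ℝ → ℂ) (hμ : IntegrableOn (kernelSup a K) (Ioi a)) :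
    domMeas a K univ = ENNReal.ofReal (∫ s in Ioi a, kernelSup a K s) := by
  rw [domMeas, withDensity_apply _ MeasurableSet.univ, Measure.restrict_univ,
    ofReal_integral_eq_lintegral_ofReal hμ (ae_of_all _ (kernelSup_nonneg a K))]

lemma domMeas_finite (a : ℝ) (K : ℝ → ℝ → ℂ) (hμ : IntegrableOn (kernelSup a K) (Ioi a)) :
    IsFiniteMeasure (domMeas a K) :=
  ⟨by rw [domMeas_univ a K hμ]; exact ENNReal.ofReal_lt_top⟩

lemma domMeas_nsc (a : ℝ) (K : ℝ → ℝ → ℂ) : NullSingletonClass (domMeas a K) := by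
  refine ⟨fun x => ?_⟩
  exact withDensity_absolutelyContinuous _ _ (by simp)

lemma step_bound (a : ℝ) (K : ℝ → ℝ → ℂ)
    (hbdd : ∀ s ∈ Ioi a, BddAbove ((fun x => ‖K x s‖) '' Ioo a s))
    (hμ : IntegrableOn (kernelSup a K) (Ioi a)) (C : ℝ≥0∞) (h : ℝ → ℝ≥0∞) (n : ℕ)
    (hh : ∀ s ∈ Ioi a, h s ≤ C * (domMeas a K (Ioi s) ^ n / (n.factorial : ℝ≥0∞)))
    (x : ℝ) (hx : x ∈ Ioi a) :
    ∫⁻ s in Ioi x, ‖K x s‖ₑ * h s ≤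
      C * (domMeas a K (Ioi x) ^ (n + 1) / ((n + 1).factorial : ℝ≥0∞)) := by
  have := domMeas_finite a K hμ
  have := domMeas_nsc a K
  set m := domMeas a K with hm
  have hT : Measurable fun s : ℝ => m (Ioi s) :=
    Antitone.measurable fun s t h => measure_mono (Ioi_subset_Ioi h)
  have hk : AEMeasurable (fun s => ENNReal.ofReal (kernelSup a K s)) (volume.restrict (Ioi a)) :=
    hμ.aestronglyMeasurable.aemeasurable.ennreal_ofReal
  have hsub : Ioi x ⊆ Ioi a := Ioi_subset_Ioi (le_of_lt hx)
  have hres : m.restrict (Ioi x) =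
      (volume.restrict (Ioi x)).withDensity fun s => ENNReal.ofReal (kernelSup a K s) := by
    rw [hm, domMeas, restrict_withDensity measurableSet_Ioi,
      Measure.restrict_restrict measurableSet_Ioi, inter_eq_left.2 hsub]
  calc ∫⁻ s in Ioi x, ‖K x s‖ₑ * h s
      ≤ ∫⁻ s in Ioi x, ENNReal.ofReal (kernelSup a K s) *
          (C * (m (Ioi s) ^ n / (n.factorial : ℝ≥0∞))) := by
        refine setLIntegral_mono_ae' measurableSet_Ioi (ae_of_all _ fun s hs => ?_)
        refine mul_le_mul' ?_ (hh s (hsub hs))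
        rw [← ofReal_norm]
        exact ENNReal.ofReal_le_ofReal (le_csSup (hbdd s (hsub hs)) ⟨x, ⟨hx, hs⟩, rfl⟩)
    _ = ∫⁻ s in Ioi x, C * (m (Ioi s) ^ n / (n.factorial : ℝ≥0∞)) ∂m := by
        rw [hres, lintegral_withDensity_eq_lintegral_mul₀
          (hk.mono_measure (Measure.restrict_mono_set _ hsub))]
        · rfl
        · exact (((hT.pow_const n).div_const _).const_mul C).aemeasurable
    _ = C * (m (Ioi x) ^ (n + 1) / ((n + 1).factorial : ℝ≥0∞)) := by
        rw [lintegral_const_mul _ ((hT.pow_const n).div_const _), tail_pow m n x]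
        simp_rw [div_eq_mul_inv]
        rw [lintegral_mul_const _ (hT.pow_const n), Nat.factorial_succ, Nat.cast_mul,
          ENNReal.mul_inv (Or.inr (ENNReal.natCast_ne_top _)) (Or.inl (ENNReal.natCast_ne_top _))]
        congr 1
        generalize ∫⁻ s in Ioi x, m (Ioi s) ^ n ∂m = I
        have : ((n + 1 : ℕ) : ℝ≥0∞) * ((n + 1 : ℕ) : ℝ≥0∞)⁻¹ = 1 :=
          ENNReal.mul_inv_cancel (by simp) (ENNReal.natCast_ne_top _)
        calc I * (n.factorial : ℝ≥0∞)⁻¹ = 1 * (I * (n.factorial : ℝ≥0∞)⁻¹) := (one_mul _).symm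
          _ = _ := by rw [← this]; ring

/-- The integrand of `volterraIter`. -/
noncomputable def vInt (a : ℝ) (K : ℝ → ℝ → ℂ) (g : ℝ → ℂ) (n : ℕ) (z : Fin (n + 1) → ℝ) : ℂ :=
  (∏ i : Fin n, if a < z i.succ ∧ z i.castSucc < z i.succ then K (z i.castSucc) (z i.succ) else 0)
      * g (z (Fin.last n))

lemma volterraIter_eq (a : ℝ) (K : ℝ → ℝ → ℂ) (g : ℝ → ℂ) (n : ℕ) (x : ℝ) :
    volterraIter a K g n x = ∫ y : Fin n → ℝ, vInt a K g n (Fin.cons x y) := rfl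

lemma vInt_measurable (a : ℝ) (K : ℝ → ℝ → ℂ) (g : ℝ → ℂ)
    (hK : Measurable (Function.uncurry K)) (hgm : Measurable g) (n : ℕ) :
    Measurable (vInt a K g n) := by
  unfold vInt
  refine Measurable.mul ?_ (hgm.comp (measurable_pi_apply _))
  refine Finset.measurable_prod _ fun i _ => ?_
  refine Measurable.ite ?_ ?_ measurable_const
  · exact (measurableSet_lt measurable_const (measurable_pi_apply _)).inter
      (measurableSet_lt (measurable_pi_apply _) (measurable_pi_apply _))
  · have h : Measurable fun z : Fin (n + 1) → ℝ => (z i.castSucc, z i.succ) :=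
      (measurable_pi_apply i.castSucc).prodMk (measurable_pi_apply i.succ)
    exact hK.comp h

lemma cons_measurable (n : ℕ) :
    Measurable fun p : ℝ × (Fin n → ℝ) => (Fin.cons p.1 p.2 : Fin (n + 1) → ℝ) := by
  refine measurable_pi_iff.2 fun i => ?_
  refine Fin.cases ?_ (fun j => ?_) i
  · simpa using measurable_fst
  · exact (measurable_pi_apply j).comp measurable_snd

lemma vInt_succ (a : ℝ) (K : ℝ → ℝ → ℂ) (g : ℝ → ℂ) (n : ℕ) (x s : ℝ) (y : Fin n → ℝ) :
    vInt a K g (n + 1) (Fin.cons x (Fin.cons s y : Fin (n + 1) → ℝ)) =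
      (if a < s ∧ x < s then K x s else 0) * vInt a K g n (Fin.cons s y) := by
  unfold vInt
  rw [Fin.prod_univ_succ, mul_assoc]
  congr 1

lemma kern_measurable (a : ℝ) (K : ℝ → ℝ → ℂ) (hK : Measurable (Function.uncurry K)) (x : ℝ) :
    Measurable fun s => if a < s ∧ x < s then K x s else 0 :=
  Measurable.ite ((measurableSet_lt measurable_const measurable_id).inter
      (measurableSet_lt measurable_const measurable_id))
    (hK.comp measurable_prodMk_left) measurable_const

lemma kern_eq_indicator (a : ℝ) (K : ℝ → ℝ → ℂ) (x : ℝ) (hx : x ∈ Ioi a) :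
    (fun s => if a < s ∧ x < s then K x s else 0) = (Ioi x).indicator (K x) := by
  ext s
  by_cases h : x < s
  · simp [h, lt_trans hx h]
  · simp [h]

lemma vInt_slice (a : ℝ) (K : ℝ → ℝ → ℂ) (g : ℝ → ℂ)
    (hK : Measurable (Function.uncurry K)) (hgm : Measurable g) (n : ℕ) (s : ℝ) :
    Measurable fun y : Fin n → ℝ => ‖vInt a K g n (Fin.cons s y)‖ₑ := by
  have h : Measurable fun y : Fin n → ℝ => (Fin.cons s y : Fin (n + 1) → ℝ) := by
    refine measurable_pi_iff.2 fun i => ?_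
    refine Fin.cases ?_ (fun j => ?_) i
    · simp
    · exact measurable_pi_apply j
  exact ((vInt_measurable a K g hK hgm n).comp h).enorm

lemma vInt_lintegral_succ (a : ℝ) (K : ℝ → ℝ → ℂ) (g : ℝ → ℂ)
    (hK : Measurable (Function.uncurry K)) (hgm : Measurable g) (n : ℕ) (x : ℝ) (hx : x ∈ Ioi a) :
    ∫⁻ y : Fin (n + 1) → ℝ, ‖vInt a K g (n + 1) (Fin.cons x y)‖ₑ
      = ∫⁻ s in Ioi x, ‖K x s‖ₑ * ∫⁻ y : Fin n → ℝ, ‖vInt a K g n (Fin.cons s y)‖ₑ := by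
  have hm1 : Measurable fun p : ℝ × (Fin n → ℝ) => ‖vInt a K g n (Fin.cons p.1 p.2)‖ₑ :=
    ((vInt_measurable a K g hK hgm n).comp (cons_measurable n)).enorm
  have hm2 : Measurable fun p : ℝ × (Fin n → ℝ) =>
      ‖vInt a K g (n + 1) (Fin.cons x (Fin.cons p.1 p.2 : Fin (n + 1) → ℝ))‖ₑ := by
    simp_rw [vInt_succ, enorm_mul]
    exact ((kern_measurable a K hK x).comp measurable_fst).enorm.mul hm1
  have mp := volume_preserving_piFinSuccAbove (fun _ : Fin (n + 1) => ℝ) 0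
  have e : ∀ y : Fin (n + 1) → ℝ, (Fin.cons (MeasurableEquiv.piFinSuccAbove (fun _ => ℝ) 0 y).1
      (MeasurableEquiv.piFinSuccAbove (fun _ => ℝ) 0 y).2 : Fin (n + 1) → ℝ) = y := by
    intro y
    exact Fin.cons_self_tail y
  obtain ⟨H, hHdef⟩ : ∃ H : ℝ × (Fin n → ℝ) → ℝ≥0∞, H = fun p =>
    ‖vInt a K g (n + 1) (Fin.cons x (Fin.cons p.1 p.2 : Fin (n + 1) → ℝ))‖ₑ := ⟨_, rfl⟩
  rw [← hHdef] at hm2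
  have hH : ∀ y, H (MeasurableEquiv.piFinSuccAbove (fun _ => ℝ) 0 y)
      = ‖vInt a K g (n + 1) (Fin.cons x y)‖ₑ := fun y => by
    simp only [hHdef]; rw [e]
  have h1 := mp.lintegral_comp hm2
  simp_rw [hH] at h1
  rw [h1, Measure.volume_eq_prod]
  refine (lintegral_prod _ hm2.aemeasurable).trans ?_
  rw [← lintegral_indicator measurableSet_Ioi]
  simp only [hHdef]
  refine lintegral_congr fun s => ?_
  simp_rw [vInt_succ, enorm_mul]
  have hm3 := vInt_slice a K g hK hgm n s
  refine (lintegral_const_mul _ hm3).trans ?_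
  by_cases h : x < s
  · have h' : a < s := lt_trans hx h
    rw [if_pos ⟨h', h⟩, indicator_of_mem (show s ∈ Ioi x from h)]
  · rw [if_neg (fun hc => h hc.2), indicator_of_notMem (show s ∉ Ioi x from h)]
    simp

lemma vInt_bound (a : ℝ) (K : ℝ → ℝ → ℂ) (g : ℝ → ℂ) (G : ℝ)
    (hK : Measurable (Function.uncurry K))
    (hbdd : ∀ s ∈ Ioi a, BddAbove ((fun x => ‖K x s‖) '' Ioo a s))
    (hμ : IntegrableOn (kernelSup a K) (Ioi a))
    (hgm : Measurable g)
    (hg : ∀ x ∈ Ioi a, ‖g x‖ ≤ G) (n : ℕ) : ∀ x ∈ Ioi a,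
    ∫⁻ y : Fin n → ℝ, ‖vInt a K g n (Fin.cons x y)‖ₑ ≤
      ENNReal.ofReal G * (domMeas a K (Ioi x) ^ n / (n.factorial : ℝ≥0∞)) := by
  induction n with
  | zero =>
    intro x hx
    rw [volume_pi, Measure.pi_of_empty, lintegral_dirac]
    simp only [vInt, Finset.univ_eq_empty, Finset.prod_empty, one_mul, pow_zero, Nat.factorial_zero,
      Nat.cast_one, div_one, mul_one]
    rw [← ofReal_norm]
    exact ENNReal.ofReal_le_ofReal (hg x hx)
  | succ n ih =>
    intro x hx
    rw [vInt_lintegral_succ a K g hK hgm n x hx]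
    exact step_bound a K hbdd hμ _ _ n ih x hx

lemma volterraIter_zero (a : ℝ) (K : ℝ → ℝ → ℂ) (g : ℝ → ℂ) (x : ℝ) :
    volterraIter a K g 0 x = g x := by
  rw [volterraIter_eq, volume_pi, Measure.pi_of_empty, integral_dirac]
  simp [vInt]

lemma vInt_integrable (a : ℝ) (K : ℝ → ℝ → ℂ) (g : ℝ → ℂ) (G : ℝ)
    (hK : Measurable (Function.uncurry K))
    (hbdd : ∀ s ∈ Ioi a, BddAbove ((fun x => ‖K x s‖) '' Ioo a s))
    (hμ : IntegrableOn (kernelSup a K) (Ioi a))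
    (hgm : Measurable g)
    (hg : ∀ x ∈ Ioi a, ‖g x‖ ≤ G) (n : ℕ) (x : ℝ) (hx : x ∈ Ioi a) :
    Integrable fun y : Fin n → ℝ => vInt a K g n (Fin.cons x y) := by
  have := domMeas_finite a K hμ
  refine ⟨(((vInt_measurable a K g hK hgm n).comp (cons_measurable n)).comp
    measurable_prodMk_left).aestronglyMeasurable, ?_⟩
  refine lt_of_le_of_lt (vInt_bound a K g G hK hbdd hμ hgm hg n x hx) ?_
  refine ENNReal.mul_lt_top ENNReal.ofReal_lt_top (ENNReal.div_lt_top ?_ ?_)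
  · exact ENNReal.pow_ne_top (measure_ne_top _ _)
  · exact_mod_cast Nat.factorial_ne_zero n

lemma volterraIter_succ (a : ℝ) (K : ℝ → ℝ → ℂ) (g : ℝ → ℂ) (G : ℝ)
    (hK : Measurable (Function.uncurry K))
    (hbdd : ∀ s ∈ Ioi a, BddAbove ((fun x => ‖K x s‖) '' Ioo a s))
    (hμ : IntegrableOn (kernelSup a K) (Ioi a))
    (hgm : Measurable g)
    (hg : ∀ x ∈ Ioi a, ‖g x‖ ≤ G) (n : ℕ) (x : ℝ) (hx : x ∈ Ioi a) :
    volterraIter a K g (n + 1) x = ∫ s in Ioi x, K x s * volterraIter a K g n s := by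
  have hInt := vInt_integrable a K g G hK hbdd hμ hgm hg (n + 1) x hx
  have mp := volume_preserving_piFinSuccAbove (fun _ : Fin (n + 1) => ℝ) 0
  have e : ∀ y : Fin (n + 1) → ℝ, (Fin.cons (MeasurableEquiv.piFinSuccAbove (fun _ => ℝ) 0 y).1
      (MeasurableEquiv.piFinSuccAbove (fun _ => ℝ) 0 y).2 : Fin (n + 1) → ℝ) = y := by
    intro y
    exact Fin.cons_self_tail y
  let H : ℝ × (Fin n → ℝ) → ℂ := fun p =>
    vInt a K g (n + 1) (Fin.cons x (Fin.cons p.1 p.2 : Fin (n + 1) → ℝ))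
  have hH : ∀ y, H (MeasurableEquiv.piFinSuccAbove (fun _ => ℝ) 0 y)
      = vInt a K g (n + 1) (Fin.cons x y) := fun y => by
    simp only [H]; rw [e]
  have hHi : Integrable H (volume.prod volume) := by
    have := (mp.integrable_comp_emb (MeasurableEquiv.measurableEmbedding _) (g := H)).1
      (hInt.congr (ae_of_all _ fun y => (hH y).symm))
    exact this
  have := mp.integral_comp' H
  simp_rw [hH] at this
  rw [volterraIter_eq, this, Measure.volume_eq_prod]
  refine (integral_prod _ hHi).trans ?_
  rw [← integral_indicator measurableSet_Ioi]
  refine integral_congr_ae (ae_of_all _ fun s => ?_)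
  simp only [H]
  simp_rw [vInt_succ]
  rw [integral_const_mul, ← volterraIter_eq]
  have := congrFun (kern_eq_indicator a K x hx) s
  rw [this]
  by_cases h : s ∈ Ioi x <;> simp [h]

lemma volterraIter_measurable (a : ℝ) (K : ℝ → ℝ → ℂ) (g : ℝ → ℂ)
    (hK : Measurable (Function.uncurry K)) (hgm : Measurable g) (n : ℕ) :
    StronglyMeasurable (volterraIter a K g n) := by
  have : StronglyMeasurable (Function.uncurry fun (x : ℝ) (y : Fin n → ℝ) =>
      vInt a K g n (Fin.cons x y)) :=
    ((vInt_measurable a K g hK hgm n).comp (cons_measurable n)).stronglyMeasurable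
  exact this.integral_prod_right

lemma volterraIter_enorm (a : ℝ) (K : ℝ → ℝ → ℂ) (g : ℝ → ℂ) (G : ℝ)
    (hK : Measurable (Function.uncurry K))
    (hbdd : ∀ s ∈ Ioi a, BddAbove ((fun x => ‖K x s‖) '' Ioo a s))
    (hμ : IntegrableOn (kernelSup a K) (Ioi a))
    (hgm : Measurable g)
    (hg : ∀ x ∈ Ioi a, ‖g x‖ ≤ G) (n : ℕ) (x : ℝ) (hx : x ∈ Ioi a) :
    ‖volterraIter a K g n x‖ₑ ≤
      ENNReal.ofReal G * (domMeas a K (Ioi x) ^ n / (n.factorial : ℝ≥0∞)) :=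
  (enorm_integral_le_lintegral_enorm _).trans (vInt_bound a K g G hK hbdd hμ hgm hg n x hx)

/-- A largest measurable set on which `f` is a.e. strongly measurable. -/
lemma exists_max_meas (ρ : Measure ℝ) [SFinite ρ] (f : ℝ → ℂ) :
    ∃ E, MeasurableSet E ∧ AEStronglyMeasurable f (ρ.restrict E) ∧
      ∀ F, MeasurableSet F → AEStronglyMeasurable f (ρ.restrict F) → ρ (F \ E) = 0 := by
  let S : Set ℝ≥0∞ := (fun F => ρ.toFinite F) ''
    {F | MeasurableSet F ∧ AEStronglyMeasurable f (ρ.restrict F)}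
  have hS : S.Nonempty := ⟨_, ∅, ⟨MeasurableSet.empty, by simp⟩, rfl⟩
  obtain ⟨u, -, hu, hmem⟩ := exists_seq_tendsto_sSup hS (OrderTop.bddAbove S)
  choose F hF hFu using hmem
  have hE : MeasurableSet (⋃ n, F n) := MeasurableSet.iUnion fun n => (hF n).1
  have hEm : AEStronglyMeasurable f (ρ.restrict (⋃ n, F n)) :=
    aestronglyMeasurable_iUnion_iff.2 fun n => (hF n).2
  refine ⟨⋃ n, F n, hE, hEm, fun F' hF' hF'm => ?_⟩
  have h1 : sSup S ≤ ρ.toFinite (⋃ n, F n) := by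
    refine le_of_tendsto' hu fun n => ?_
    rw [← hFu n]
    exact measure_mono (subset_iUnion F n)
  have h2 : ρ.toFinite ((⋃ n, F n) ∪ F') ≤ sSup S :=
    le_sSup ⟨_, ⟨hE.union hF', aestronglyMeasurable_union_iff.2 ⟨hEm, hF'm⟩⟩, rfl⟩
  apply absolutelyContinuous_toFinite ρ
  have h3 : ρ.toFinite ((⋃ n, F n) ∪ F') =
      ρ.toFinite (⋃ n, F n) + ρ.toFinite (F' \ ⋃ n, F n) := by
    rw [← measure_union disjoint_sdiff_right (hF'.diff hE), union_sdiff_self]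
  have h4 := h2.trans h1
  rw [h3] at h4
  by_contra h0
  exact absurd h4 (not_le.2 (ENNReal.lt_add_right (measure_ne_top _ _) h0))

/-- Any solution of the equation is automatically a.e. measurable. -/
lemma solution_meas (a : ℝ) (K : ℝ → ℝ → ℂ) (g f : ℝ → ℂ)
    (hK : Measurable (Function.uncurry K)) (hgm : Measurable g)
    (hf : ∀ x ∈ Ioi a, f x = g x + ∫ s in Ioi x, K x s * f s) :
    AEStronglyMeasurable f (volume.restrict (Ioi a)) := by
  classical
  obtain ⟨E, hE, hEm, hmax⟩ := exists_max_meas (volume.restrict (Ioi a)) f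
  obtain ⟨φ, hφ, hφe⟩ := hEm
  let ψ : ℝ → ℂ := E.indicator φ
  have hψ : Measurable ψ := hφ.measurable.indicator hE
  let H : ℝ → ℂ := fun x => ∫ s, if x < s then K x s * ψ s else 0
  have hH : StronglyMeasurable H := by
    have : StronglyMeasurable (Function.uncurry fun x s : ℝ => if x < s then K x s * ψ s else 0) :=
      (Measurable.ite (measurableSet_lt measurable_fst measurable_snd)
        (hK.mul (hψ.comp measurable_snd)) measurable_const).stronglyMeasurable
    exact this.integral_prod_right
  let L : ℝ → ℝ≥0∞ := fun x => ∫⁻ s, if x < s ∧ a < s ∧ s ∉ E then ‖K x s‖ₑ else 0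
  have hLf : Measurable (Function.uncurry fun x s : ℝ =>
      if x < s ∧ a < s ∧ s ∉ E then ‖K x s‖ₑ else 0) :=
    Measurable.ite ((measurableSet_lt measurable_fst measurable_snd).inter
        ((measurableSet_lt measurable_const measurable_snd).inter (measurable_snd hE.compl)))
      hK.enorm measurable_const
  have hL : Measurable L := hLf.lintegral_prod_right
  let B : Set ℝ := L ⁻¹' {0}
  have hB : MeasurableSet B := hL (measurableSet_singleton 0)
  have hKx : ∀ x, Measurable (K x) := fun x => hK.comp measurable_prodMk_left
  have key : ∀ x ∈ Ioi a, f x = g x + B.indicator H x := by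
    intro x hx
    rw [hf x hx]
    congr 1
    have hsub : Ioi x ⊆ Ioi a := Ioi_subset_Ioi (le_of_lt hx)
    by_cases hxB : x ∈ B
    · rw [indicator_of_mem hxB]
      have h0 : (fun s => if x < s ∧ a < s ∧ s ∉ E then ‖K x s‖ₑ else 0) =ᵐ[volume] 0 :=
        (lintegral_eq_zero_iff (hLf.comp measurable_prodMk_left)).1 hxB
      have h1 : ∀ᵐ s, s ∈ E → s ∈ Ioi a → f s = φ s := by
        have h := hφe
        rw [Filter.EventuallyEq, ae_restrict_iff' hE, ae_restrict_iff' measurableSet_Ioi] at h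
        filter_upwards [h] with s hs h1 h2 using hs h2 h1
      rw [← integral_indicator measurableSet_Ioi]
      refine integral_congr_ae ?_
      filter_upwards [h0, h1] with s hs0 hs1
      by_cases hs : x < s
      · have hs' : a < s := lt_trans hx hs
        by_cases hsE : s ∈ E
        · simp [hs, ψ, hsE, hs1 hsE hs']
        · have : K x s = 0 := by simpa [hs, hs', hsE] using hs0
          simp [hs, this]
      · simp [hs]
    · rw [indicator_of_notMem hxB]
      apply integral_undef
      intro hi
      apply hxB
      let F : Set ℝ := {s | x < s ∧ K x s ≠ 0}
      have hF : MeasurableSet F := measurableSet_Ioi.inter (hKx x (measurableSet_singleton 0).compl)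
      have hFa : F ⊆ Ioi x := fun s hs => hs.1
      have hm : AEStronglyMeasurable f ((volume.restrict (Ioi a)).restrict F) := by
        rw [Measure.restrict_restrict hF, inter_eq_left.2 (hFa.trans hsub)]
        have h1 : AEStronglyMeasurable (fun s => (K x s)⁻¹ * (K x s * f s)) (volume.restrict F) :=
          (hKx x).inv.aestronglyMeasurable.mul
            (hi.aestronglyMeasurable.mono_measure (Measure.restrict_mono_set _ hFa))
        refine h1.congr ?_
        filter_upwards [ae_restrict_mem hF] with s hs
        rw [inv_mul_cancel_left₀ hs.2]
      have h0 := hmax F hF hm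
      have h0' : ∀ᵐ s, s ∈ Ioi a → s ∉ F \ E := by
        have := measure_eq_zero_iff_ae_notMem.1 h0
        rwa [ae_restrict_iff' measurableSet_Ioi] at this
      change L x = 0
      refine (lintegral_eq_zero_iff (hLf.comp measurable_prodMk_left)).2 ?_
      filter_upwards [h0'] with s hs
      by_cases hc : x < s ∧ a < s ∧ s ∉ E
      · have h1 := hs hc.2.1
        have : K x s = 0 := by
          by_contra hne
          exact h1 ⟨⟨hc.1, hne⟩, hc.2.2⟩
        simp [this]
      · simp [hc]
  refine AEStronglyMeasurable.congr (f := fun x => g x + B.indicator H x) ?_ ?_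
  · exact (hgm.stronglyMeasurable.add (hH.indicator hB)).aestronglyMeasurable
  · filter_upwards [ae_restrict_mem measurableSet_Ioi] with x hx using (key x hx).symm

/-- Integrability of `K x · * f` for bounded measurable `f`. -/
lemma kernel_integrable (a : ℝ) (K : ℝ → ℝ → ℂ)
    (hK : Measurable (Function.uncurry K))
    (hbdd : ∀ s ∈ Ioi a, BddAbove ((fun x => ‖K x s‖) '' Ioo a s))
    (hμ : IntegrableOn (kernelSup a K) (Ioi a)) (f : ℝ → ℂ) (M : ℝ)
    (hfm : AEStronglyMeasurable f (volume.restrict (Ioi a)))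
    (hf : ∀ x ∈ Ioi a, ‖f x‖ ≤ M) (x : ℝ) (hx : x ∈ Ioi a) :
    IntegrableOn (fun s => K x s * f s) (Ioi x) := by
  have hsub : Ioi x ⊆ Ioi a := Ioi_subset_Ioi (le_of_lt hx)
  refine Integrable.mono' (g := fun s => kernelSup a K s * M) ((hμ.mono_set hsub).mul_const M) ?_ ?_
  · exact (hK.comp measurable_prodMk_left).aestronglyMeasurable.mul
      (hfm.mono_measure (Measure.restrict_mono_set _ hsub))
  · filter_upwards [ae_restrict_mem measurableSet_Ioi] with s hs
    rw [norm_mul]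
    exact mul_le_mul (le_csSup (hbdd s (hsub hs)) ⟨x, ⟨hx, hs⟩, rfl⟩) (hf s (hsub hs))
      (norm_nonneg _) (kernelSup_nonneg a K s)

/-- Real form of the `ℝ≥0∞` bounds. -/
lemma norm_le_of_enorm (z : ℂ) (C : ℝ) (hC : 0 ≤ C) (t : ℝ≥0∞) (ht : t ≠ ∞) (n : ℕ)
    (h : ‖z‖ₑ ≤ ENNReal.ofReal C * (t ^ n / (n.factorial : ℝ≥0∞))) :
    ‖z‖ ≤ C * (t.toReal ^ n / (n.factorial : ℝ)) := by
  have hfin : ENNReal.ofReal C * (t ^ n / (n.factorial : ℝ≥0∞)) ≠ ∞ :=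
    ENNReal.mul_ne_top ENNReal.ofReal_ne_top (ENNReal.div_lt_top (ENNReal.pow_ne_top ht)
      (by exact_mod_cast Nat.factorial_ne_zero n)).ne
  have := ENNReal.toReal_mono hfin h
  simpa [ENNReal.toReal_mul, ENNReal.toReal_div, ENNReal.toReal_ofReal hC] using this

theorem volterra_solution (a : ℝ) (K : ℝ → ℝ → ℂ) (g : ℝ → ℂ) (G : ℝ)
    (hK : Measurable (Function.uncurry K))
    (hbdd : ∀ s ∈ Ioi a, BddAbove ((fun x => ‖K x s‖) '' Ioo a s))
    (hμ : IntegrableOn (kernelSup a K) (Ioi a))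
    (hgm : Measurable g)
    (hg : ∀ x ∈ Ioi a, ‖g x‖ ≤ G) :
    ∃ f : ℝ → ℂ,
      (∀ x ∈ Ioi a, HasSum (fun n => volterraIter a K g n x) (f x)) ∧
      (∀ x ∈ Ioi a, f x = g x + ∫ s in Ioi x, K x s * f s) ∧
      (∀ x ∈ Ioi a, ‖f x‖ ≤ Real.exp (∫ s in Ioi a, kernelSup a K s) * G) ∧
      ∀ f' : ℝ → ℂ, (∃ M, ∀ x ∈ Ioi a, ‖f' x‖ ≤ M) →
        (∀ x ∈ Ioi a, f' x = g x + ∫ s in Ioi x, K x s * f' s) →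
        Set.EqOn f' f (Ioi a) := by
  have := domMeas_finite a K hμ
  have hG : 0 ≤ G := (norm_nonneg _).trans (hg (a + 1) (by simp))
  set μ : ℝ := ∫ s in Ioi a, kernelSup a K s with hμdef
  have hμ0 : 0 ≤ μ := integral_nonneg (kernelSup_nonneg a K)
  have hTμ : ∀ x, (domMeas a K (Ioi x)).toReal ≤ μ := fun x => by
    refine ENNReal.toReal_le_of_le_ofReal hμ0 ?_
    rw [hμdef, ← domMeas_univ a K hμ]
    exact measure_mono (subset_univ _)
  have up : ∀ (z : ℂ) (C : ℝ), 0 ≤ C → ∀ (x : ℝ) (n : ℕ),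
      ‖z‖ₑ ≤ ENNReal.ofReal C * (domMeas a K (Ioi x) ^ n / (n.factorial : ℝ≥0∞)) →
      ‖z‖ ≤ C * (μ ^ n / (n.factorial : ℝ)) := by
    intro z C hC x n h
    refine (norm_le_of_enorm z C hC _ (measure_ne_top _ _) n h).trans ?_
    have := hTμ x
    gcongr
  have hb : ∀ n, ∀ x ∈ Ioi a, ‖volterraIter a K g n x‖ ≤ G * (μ ^ n / (n.factorial : ℝ)) :=
    fun n x hx => up _ G hG x n (volterraIter_enorm a K g G hK hbdd hμ hgm hg n x hx)
  have hexp : HasSum (fun n : ℕ => G * (μ ^ n / (n.factorial : ℝ))) (G * Real.exp μ) := by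
    have := NormedSpace.expSeries_div_hasSum_exp μ
    rw [← Real.exp_eq_exp_ℝ] at this
    exact this.mul_left G
  let f : ℝ → ℂ := fun x => ∑' n, volterraIter a K g n x
  have hsum : ∀ x ∈ Ioi a, HasSum (fun n => volterraIter a K g n x) (f x) := fun x hx =>
    (Summable.of_norm_bounded hexp.summable fun n => hb n x hx).hasSum
  have hfb : ∀ x ∈ Ioi a, ‖f x‖ ≤ Real.exp μ * G := fun x hx => by
    rw [mul_comm]
    exact tsum_of_norm_bounded hexp fun n => hb n x hx
  have hfm : AEStronglyMeasurable f (volume.restrict (Ioi a)) := by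
    refine aestronglyMeasurable_of_tendsto_ae atTop
      (f := fun (N : ℕ) x => ∑ n ∈ Finset.range N, volterraIter a K g n x) ?_ ?_
    · intro N
      exact (Finset.stronglyMeasurable_fun_sum _
        fun n _ => volterraIter_measurable a K g hK hgm n).aestronglyMeasurable
    · filter_upwards [ae_restrict_mem measurableSet_Ioi] with x hx
      exact (hsum x hx).tendsto_sum_nat
  have hfe : ∀ x ∈ Ioi a, f x = g x + ∫ s in Ioi x, K x s * f s := by
    intro x hx
    have hsub : Ioi x ⊆ Ioi a := Ioi_subset_Ioi (le_of_lt hx)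
    have hI : ∀ n, IntegrableOn (fun s => K x s * volterraIter a K g n s) (Ioi x) := fun n =>
      kernel_integrable a K hK hbdd hμ _ _
        (volterraIter_measurable a K g hK hgm n).aestronglyMeasurable (hb n) x hx
    have hsn : Summable fun n => ∫ s in Ioi x, ‖K x s * volterraIter a K g n s‖ := by
      refine Summable.of_nonneg_of_le (fun n => integral_nonneg fun s => norm_nonneg _)
        (f := fun n : ℕ => μ * (G * (μ ^ n / (n.factorial : ℝ)))) (fun n => ?_)
        (hexp.summable.mul_left μ)
      have hpos : 0 ≤ G * (μ ^ n / (n.factorial : ℝ)) := by positivity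
      calc ∫ s in Ioi x, ‖K x s * volterraIter a K g n s‖
          ≤ ∫ s in Ioi x, kernelSup a K s * (G * (μ ^ n / (n.factorial : ℝ))) := by
            refine setIntegral_mono_on (hI n).norm ((hμ.mono_set hsub).mul_const _)
              measurableSet_Ioi fun s hs => ?_
            rw [norm_mul]
            exact mul_le_mul (le_csSup (hbdd s (hsub hs)) ⟨x, ⟨hx, hs⟩, rfl⟩) (hb n s (hsub hs))
              (norm_nonneg _) (kernelSup_nonneg a K s)
        _ = (∫ s in Ioi x, kernelSup a K s) * (G * (μ ^ n / (n.factorial : ℝ))) :=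
            integral_mul_const _ _
        _ ≤ μ * (G * (μ ^ n / (n.factorial : ℝ))) := by
            refine mul_le_mul_of_nonneg_right ?_ hpos
            exact setIntegral_mono_set hμ (ae_of_all _ (kernelSup_nonneg a K))
              (LE.le.eventuallyLE hsub)
    have h1 := hasSum_integral_of_summable_integral_norm hI hsn
    have h2 : ∫ s in Ioi x, ∑' n, K x s * volterraIter a K g n s = ∫ s in Ioi x, K x s * f s :=
      integral_congr_ae (ae_of_all _ fun s => tsum_mul_left)
    rw [h2] at h1
    have h3 := (hasSum_nat_add_iff' 1).2 (hsum x hx)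
    simp_rw [volterraIter_succ a K g G hK hbdd hμ hgm hg _ x hx] at h3
    have h4 := h3.unique h1
    rw [Finset.sum_range_one, volterraIter_zero] at h4
    rw [← h4]; ring
  refine ⟨f, hsum, hfe, hfb, ?_⟩
  rintro f' ⟨M, hM⟩ hf'
  have hM0 : 0 ≤ M := (norm_nonneg _).trans (hM (a + 1) (by simp))
  have hf'm := solution_meas a K g f' hK hgm hf'
  have hd : ∀ x ∈ Ioi a, f' x - f x = ∫ s in Ioi x, K x s * (f' s - f s) := by
    intro x hx
    simp_rw [mul_sub]
    rw [integral_sub (kernel_integrable a K hK hbdd hμ f' M hf'm hM x hx)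
      (kernel_integrable a K hK hbdd hμ f _ hfm hfb x hx), hf' x hx, hfe x hx]
    ring
  set C : ℝ := M + Real.exp μ * G with hC
  have hC0 : 0 ≤ C := by positivity
  have hdn : ∀ n : ℕ, ∀ x ∈ Ioi a, ‖f' x - f x‖ₑ ≤
      ENNReal.ofReal C * (domMeas a K (Ioi x) ^ n / (n.factorial : ℝ≥0∞)) := by
    intro n
    induction n with
    | zero =>
      intro x hx
      simp only [pow_zero, Nat.factorial_zero, Nat.cast_one, div_one, mul_one]
      rw [← ofReal_norm]
      exact ENNReal.ofReal_le_ofReal ((norm_sub_le _ _).trans (add_le_add (hM x hx) (hfb x hx)))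
    | succ n ih =>
      intro x hx
      rw [hd x hx]
      refine (enorm_integral_le_lintegral_enorm _).trans ?_
      simp_rw [enorm_mul]
      exact step_bound a K hbdd hμ _ _ n ih x hx
  intro x hx
  have hlim : Tendsto (fun n : ℕ => C * (μ ^ n / (n.factorial : ℝ))) atTop (𝓝 0) := by
    simpa using (FloorSemiring.tendsto_pow_div_factorial_atTop μ).const_mul C
  have : ‖f' x - f x‖ ≤ 0 := ge_of_tendsto' hlim fun n => up _ C hC0 x n (hdn n x hx)
  exact sub_eq_zero.1 (norm_le_zero_iff.1 this)
end

section
/- (Stationary phase with precise error control) Let $\phi:\mathbb{R}\to\mathbb{R}$ satisfy $\phi(0)=\phi'(0)=0$ and $1\le\phi''\le C$. Then for $t>0$ and $\delta=t^{-1/2}$, $\Big|\int_{-\infty}^\infty e^{it\phi(x)}a(x)\,dx\Big|\lesssim \delta^2\Big\{\int \frac{|a(x)|}{\delta^2+|x|^2}\,dx+\int_{|x|>\delta}\frac{|a'(x)|}{|x|}\,dx\Big\}$ for all $a\in C^1$ for which the right-hand side is finite, with an implicit constant depending only on $C$. -/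
open MeasureTheory

lemma sp_half (C : ℝ) (hC : 1 ≤ C) (φ : ℝ → ℝ) (a : ℝ → ℂ) (t δ : ℝ) (ht : 0 < t) (hδ : 0 < δ)
    (hδt : δ ^ 2 = t⁻¹)
    (hφ : ContDiff ℝ 2 φ) (hφ1 : deriv φ 0 = 0)
    (hφ2 : ∀ x, 1 ≤ deriv (deriv φ) x ∧ deriv (deriv φ) x ≤ C)
    (ha : ContDiff ℝ 1 a) (hai : Integrable a)
    (hA : Integrable (fun x : ℝ => ‖a x‖ / (t⁻¹ + |x| ^ 2)))
    (hB : IntegrableOn (fun x : ℝ => ‖deriv a x‖ / |x|) (Set.Ioi δ)) :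
    ‖∫ x in Set.Ioi δ, Complex.exp (Complex.I * (t : ℂ) * (φ x : ℂ)) * a x‖ ≤
      (2 * C + 6) * t⁻¹ * ((∫ x in Set.Ioi δ, ‖a x‖ / (t⁻¹ + |x| ^ 2)) +
          ∫ x in Set.Ioi δ, ‖deriv a x‖ / |x|) := by
  have hd1 : Differentiable ℝ φ := hφ.differentiable (by norm_num)
  have hφ' : ContDiff ℝ 1 (deriv φ) := by
    have : ContDiff ℝ (1 + 1) φ := by simpa [one_add_one_eq_two] using hφ
    exact (contDiff_succ_iff_deriv.1 this).2.2
  have hd2 : Differentiable ℝ (deriv φ) := hφ'.differentiable (by norm_num)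
  have hda : Differentiable ℝ a := ha.differentiable (by norm_num)
  have hlow : ∀ x, 0 ≤ x → x ≤ deriv φ x := by
    have hm : Monotone (fun x => deriv φ x - x) := by
      apply monotone_of_deriv_nonneg (by fun_prop)
      intro x
      rw [deriv_fun_sub hd2.differentiableAt (by fun_prop)]
      simp only [deriv_id'']
      linarith [(hφ2 x).1]
    intro x hx
    have := hm hx
    simp only [hφ1] at this
    linarith
  set e : ℝ → ℂ := fun x => Complex.exp (Complex.I * (t : ℂ) * (φ x : ℂ)) with he
  have hen : ∀ x, ‖e x‖ = 1 := by
    intro x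
    have : Complex.I * (t : ℂ) * (φ x : ℂ) = ((t * φ x : ℝ) : ℂ) * Complex.I := by
      push_cast; ring
    simp only [he]
    rw [this, Complex.norm_exp_ofReal_mul_I]
  have hec : Continuous e := by
    have := hφ.continuous
    simp only [he]; fun_prop
  have hedi : ∀ x, HasDerivAt e (e x * (Complex.I * t * ((deriv φ x : ℝ) : ℂ))) x := by
    intro x
    have h1 : HasDerivAt (fun x => (φ x : ℂ)) ((deriv φ x : ℝ) : ℂ) x :=
      (hd1 x).hasDerivAt.ofReal_comp
    exact (h1.const_mul (Complex.I * (t : ℂ))).cexp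
  set q : ℝ → ℝ := fun x => (1 - δ ^ 2 / x ^ 2) / deriv φ x with hq
  set q' : ℝ → ℝ := fun x => (2 * δ ^ 2 / x ^ 3 * deriv φ x -
    (1 - δ ^ 2 / x ^ 2) * deriv (deriv φ) x) / (deriv φ x) ^ 2 with hq'
  have hqd : ∀ x, 0 < x → HasDerivAt q (q' x) x := by
    intro x hx
    have hp : 0 < deriv φ x := hx.trans_le (hlow x hx.le)
    have h1 : HasDerivAt (fun x : ℝ => 1 - δ ^ 2 / x ^ 2) (2 * δ ^ 2 / x ^ 3) x := by
      have h2 := ((hasDerivAt_pow 2 x).inv (by positivity)).const_mul (δ ^ 2)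
      have h3 := h2.const_sub 1
      refine h3.congr_deriv ?_
      simp only [Nat.cast_ofNat, Nat.add_one_sub_one, pow_one]
      field_simp
    exact h1.div (hd2 x).hasDerivAt hp.ne'
  have hη : ∀ x, δ ≤ x → 0 ≤ 1 - δ ^ 2 / x ^ 2 ∧ 1 - δ ^ 2 / x ^ 2 ≤ 1 := by
    intro x hx
    have hx0 : 0 < x := hδ.trans_le hx
    constructor
    · rw [sub_nonneg, div_le_one (by positivity)]
      gcongr
    · have : 0 ≤ δ ^ 2 / x ^ 2 := by positivity
      linarith
  have hqb : ∀ x, δ ≤ x → |q x| ≤ 1 / x := by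
    intro x hx
    have hx0 : 0 < x := hδ.trans_le hx
    obtain ⟨h0, h1⟩ := hη x hx
    have hp : 0 < deriv φ x := hx0.trans_le (hlow x hx0.le)
    rw [abs_of_nonneg (div_nonneg h0 hp.le)]
    exact div_le_div₀ zero_le_one h1 hx0 (hlow x hx0.le)
  have hqb' : ∀ x, δ ≤ x → |q' x| ≤ (2 + C) / x ^ 2 := by
    intro x hx
    have hx0 : 0 < x := hδ.trans_le hx
    obtain ⟨h0, h1⟩ := hη x hx
    have hl := hlow x hx0.le
    have hp : 0 < deriv φ x := hx0.trans_le hl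
    have e1 : q' x = 2 * δ ^ 2 / x ^ 3 / deriv φ x -
      (1 - δ ^ 2 / x ^ 2) * deriv (deriv φ) x / (deriv φ x) ^ 2 := by
      simp only [hq']
      rw [sub_div]
      congr 1
      field_simp
    have b1 : 2 * δ ^ 2 / x ^ 3 / deriv φ x ≤ 2 / x ^ 2 := by
      have s1 : 2 * δ ^ 2 / x ^ 3 ≤ 2 / x := by
        rw [div_le_div_iff₀ (by positivity) hx0]
        have : δ ^ 2 ≤ x ^ 2 := by gcongr
        nlinarith
      calc 2 * δ ^ 2 / x ^ 3 / deriv φ x ≤ (2 / x) / x := by gcongr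
        _ = 2 / x ^ 2 := by field_simp
    have b2 : (1 - δ ^ 2 / x ^ 2) * deriv (deriv φ) x / (deriv φ x) ^ 2 ≤ C / x ^ 2 := by
      have h3 := (hφ2 x).2
      have h4 := (hφ2 x).1
      have : (1 - δ ^ 2 / x ^ 2) * deriv (deriv φ) x ≤ C := by nlinarith
      gcongr
    have p1 : 0 ≤ 2 * δ ^ 2 / x ^ 3 / deriv φ x := by positivity
    have p2 : 0 ≤ (1 - δ ^ 2 / x ^ 2) * deriv (deriv φ) x / (deriv φ x) ^ 2 := by
      have h4 := (hφ2 x).1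
      have : 0 ≤ deriv (deriv φ) x := by linarith
      positivity
    rw [e1, add_div, abs_le]
    constructor <;> linarith [show 0 ≤ 2 / x ^ 2 by positivity, show 0 ≤ C / x ^ 2 by positivity]
  have hIt : (Complex.I * (t : ℂ)) ≠ 0 := by
    simp [ht.ne']
  set G : ℝ → ℂ := fun x => e x / (Complex.I * t) * (a x * (q x : ℂ)) with hG
  have hGd : ∀ x, 0 < x → HasDerivAt G (e x * a x * ((1 - δ ^ 2 / x ^ 2 : ℝ) : ℂ) +
      e x / (Complex.I * t) * (deriv a x * (q x : ℂ) + a x * (q' x : ℂ))) x := by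
    intro x hx
    have hp : 0 < deriv φ x := hx.trans_le (hlow x hx.le)
    have h1 := ((hedi x).div_const (Complex.I * t)).mul
      ((hda x).hasDerivAt.mul (hqd x hx).ofReal_comp)
    refine h1.congr_deriv ?_
    congr 1
    have : ((1 - δ ^ 2 / x ^ 2 : ℝ) : ℂ) = ((deriv φ x : ℝ) : ℂ) * (q x : ℂ) := by
      rw [← Complex.ofReal_mul]; congr 1; simp only [hq]; field_simp
    rw [this]
    have ht' : (t : ℂ) ≠ 0 := by simp [ht.ne']
    simp only [Pi.mul_apply]
    field_simp
  have hEn : ∀ x, ‖e x / (Complex.I * t)‖ = t⁻¹ := by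
    intro x
    rw [norm_div, hen]; simp [abs_of_pos ht]
  set bd : ℝ → ℝ := fun x => (2 * C + 6) * t⁻¹ * (‖a x‖ / (t⁻¹ + |x| ^ 2) + ‖deriv a x‖ / |x|)
    with hbd
  have hHb : ∀ x ∈ Set.Ioi δ, ‖e x * a x - deriv G x‖ ≤ bd x := by
    intro x hx
    have hx : δ < x := hx
    have hx0 : 0 < x := hδ.trans hx
    rw [(hGd x hx0).deriv]
    have e1 : e x * a x - (e x * a x * ((1 - δ ^ 2 / x ^ 2 : ℝ) : ℂ) +
      e x / (Complex.I * t) * (deriv a x * (q x : ℂ) + a x * (q' x : ℂ))) =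
      e x * a x * ((δ ^ 2 / x ^ 2 : ℝ) : ℂ) -
      e x / (Complex.I * t) * (deriv a x * (q x : ℂ) + a x * (q' x : ℂ)) := by
      push_cast; ring
    rw [e1]
    have n1 : ‖e x * a x * ((δ ^ 2 / x ^ 2 : ℝ) : ℂ)‖ = ‖a x‖ * (t⁻¹ / x ^ 2) := by
      rw [norm_mul, norm_mul, hen, Complex.norm_real, one_mul, Real.norm_of_nonneg (by positivity),
        hδt]
    have n2 : ‖e x / (Complex.I * t) * (deriv a x * (q x : ℂ) + a x * (q' x : ℂ))‖ ≤
        t⁻¹ * (‖deriv a x‖ * (1 / x) + ‖a x‖ * ((2 + C) / x ^ 2)) := by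
      rw [norm_mul, hEn]
      gcongr
      refine (norm_add_le _ _).trans ?_
      rw [norm_mul, norm_mul, Complex.norm_real, Complex.norm_real, Real.norm_eq_abs,
        Real.norm_eq_abs]
      gcongr
      · exact hqb x hx.le
      · exact hqb' x hx.le
    have n3 : 1 / x ^ 2 ≤ 2 / (t⁻¹ + |x| ^ 2) := by
      rw [sq_abs, ← hδt, div_le_div_iff₀ (by positivity) (by positivity)]
      have : δ ^ 2 ≤ x ^ 2 := by gcongr
      linarith
    refine (norm_sub_le _ _).trans ?_
    rw [n1]
    refine (add_le_add le_rfl n2).trans ?_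
    simp only [hbd]
    rw [abs_of_pos hx0] at n3 ⊢
    have t0 : 0 < t⁻¹ := by positivity
    have k1 : ‖a x‖ * (3 + C) * (1 / x ^ 2) ≤ ‖a x‖ * (3 + C) * (2 / (t⁻¹ + x ^ 2)) := by gcongr
    have k2 : ‖deriv a x‖ / x ≤ (2 * C + 6) * (‖deriv a x‖ / x) := by
      have : 0 ≤ ‖deriv a x‖ / x := by positivity
      nlinarith
    calc _ = t⁻¹ * (‖a x‖ * (3 + C) * (1 / x ^ 2) + ‖deriv a x‖ / x) := by ring
      _ ≤ t⁻¹ * (‖a x‖ * (3 + C) * (2 / (t⁻¹ + x ^ 2)) + (2 * C + 6) * (‖deriv a x‖ / x)) := by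
        gcongr
      _ = _ := by ring
  have hbdi : IntegrableOn bd (Set.Ioi δ) := (hA.integrableOn.add hB).const_mul _
  have heai : Integrable (fun x => e x * a x) := by
    refine hai.norm.mono' (hec.mul ha.continuous).aestronglyMeasurable ?_
    filter_upwards with x
    rw [norm_mul, hen, one_mul]
  have hHi : IntegrableOn (fun x => e x * a x - deriv G x) (Set.Ioi δ) := by
    refine Integrable.mono' hbdi ?_ ?_
    · exact ((hec.mul ha.continuous).aestronglyMeasurable).sub (aestronglyMeasurable_deriv G _)
    · exact (ae_restrict_mem measurableSet_Ioi).mono hHb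
  have hG'i : IntegrableOn (deriv G) (Set.Ioi δ) := by
    have := heai.integrableOn (s := Set.Ioi δ) |>.sub hHi
    refine this.congr ?_
    filter_upwards with x
    simp
  have hGdd : ∀ x ∈ Set.Ici δ, HasDerivAt G (deriv G x) x := fun x hx =>
    (hGd x (hδ.trans_le hx)).differentiableAt.hasDerivAt
  have hGi : IntegrableOn G (Set.Ioi δ) := by
    refine Integrable.mono' ((hai.norm.const_mul (t⁻¹ * (1 / δ))).integrableOn) ?_ ?_
    · refine ContinuousOn.aestronglyMeasurable (fun x hx => ?_) measurableSet_Ioi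
      exact (hGdd x (Set.Ioi_subset_Ici_self hx)).continuousAt.continuousWithinAt
    · refine (ae_restrict_mem measurableSet_Ioi).mono fun x hx => ?_
      have hx : δ < x := hx
      have hb : |q x| ≤ 1 / δ := (hqb x hx.le).trans (by gcongr)
      simp only [hG]
      rw [norm_mul, hEn, norm_mul, Complex.norm_real, Real.norm_eq_abs]
      calc t⁻¹ * (‖a x‖ * |q x|) ≤ t⁻¹ * (‖a x‖ * (1 / δ)) := by gcongr
        _ = _ := by ring
  have hG0 : G δ = 0 := by
    simp [hG, hq, hδ.ne']
  have hlim := tendsto_zero_of_hasDerivAt_of_integrableOn_Ioi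
    (fun x hx => hGdd x (Set.Ioi_subset_Ici_self hx)) hG'i hGi
  have hint := integral_Ioi_of_hasDerivAt_of_tendsto' hGdd hG'i hlim
  rw [hG0, sub_zero] at hint
  have hsplit : ∫ x in Set.Ioi δ, e x * a x = ∫ x in Set.Ioi δ, (e x * a x - deriv G x) := by
    rw [integral_sub heai.integrableOn hG'i, hint, sub_zero]
  rw [hsplit]
  refine (norm_integral_le_of_norm_le hbdi
    ((ae_restrict_mem measurableSet_Ioi).mono hHb)).trans_eq ?_
  simp only [hbd]
  rw [integral_const_mul, integral_add hA.integrableOn hB]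


/-- Quantitative stationary phase: if `φ(0) = φ'(0) = 0` and `1 ≤ φ'' ≤ C`, then for
`t > 0` and `δ = t^{-1/2}`,
`|∫ e^{itφ(x)} a(x) dx| ≲ δ² { ∫ |a(x)|/(δ² + |x|²) dx + ∫_{|x|>δ} |a'(x)|/|x| dx }`
with an implicit constant depending only on `C`. -/
theorem stationary_phase_bound (C : ℝ) (hC : 1 ≤ C) :
    ∃ K > 0, ∀ (φ : ℝ → ℝ) (a : ℝ → ℂ) (t : ℝ), 0 < t →
      ContDiff ℝ 2 φ → φ 0 = 0 → deriv φ 0 = 0 →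
      (∀ x, 1 ≤ deriv (deriv φ) x ∧ deriv (deriv φ) x ≤ C) →
      ContDiff ℝ 1 a →
      Integrable (fun x : ℝ => ‖a x‖ / (t⁻¹ + |x| ^ 2)) →
      IntegrableOn (fun x : ℝ => ‖deriv a x‖ / |x|) {x : ℝ | t ^ (-(1:ℝ)/2) < |x|} →
      ‖∫ x : ℝ, Complex.exp (Complex.I * (t : ℂ) * (φ x : ℂ)) * a x‖ ≤
        K * t⁻¹ * ((∫ x : ℝ, ‖a x‖ / (t⁻¹ + |x| ^ 2)) +
          ∫ x in {x : ℝ | t ^ (-(1:ℝ)/2) < |x|}, ‖deriv a x‖ / |x|) := by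
  refine ⟨2 * C + 6, by linarith, ?_⟩
  intro φ a t ht hφ hφ0 hφ1 hφ2 ha hA hB
  set δ : ℝ := t ^ (-(1:ℝ)/2) with hδdef
  have hδ : 0 < δ := Real.rpow_pos_of_pos ht _
  have hδt : δ ^ 2 = t⁻¹ := by
    rw [hδdef, ← Real.rpow_natCast, ← Real.rpow_mul ht.le, ← Real.rpow_neg_one]
    norm_num
  have t0 : 0 < t⁻¹ := by positivity
  have hAn : ∀ x : ℝ, 0 ≤ ‖a x‖ / (t⁻¹ + |x| ^ 2) := fun x => by positivity
  have hBn : ∀ x : ℝ, 0 ≤ ‖deriv a x‖ / |x| := fun x => by positivity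
  have hen : ∀ x, ‖Complex.exp (Complex.I * (t : ℂ) * (φ x : ℂ))‖ = 1 := by
    intro x
    have : Complex.I * (t : ℂ) * (φ x : ℂ) = ((t * φ x : ℝ) : ℂ) * Complex.I := by
      push_cast; ring
    rw [this, Complex.norm_exp_ofReal_mul_I]
  by_cases hi : Integrable (fun x : ℝ => Complex.exp (Complex.I * (t : ℂ) * (φ x : ℂ)) * a x)
  swap
  · rw [integral_undef hi, norm_zero]
    have h1 := integral_nonneg (μ := volume) (f := fun x : ℝ => ‖a x‖ / (t⁻¹ + |x| ^ 2)) hAn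
    have h2 := integral_nonneg (μ := volume.restrict {x : ℝ | δ < |x|})
      (f := fun x : ℝ => ‖deriv a x‖ / |x|) hBn
    have : 0 ≤ 2 * C + 6 := by linarith
    positivity
  have hai : Integrable a := by
    refine hi.norm.mono' ha.continuous.aestronglyMeasurable ?_
    filter_upwards with x
    rw [norm_mul, hen, one_mul]
  have hS : {x : ℝ | δ < |x|} = Set.Iio (-δ) ∪ Set.Ioi δ := by
    ext x
    simp only [Set.mem_ofPred_eq, Set.mem_union, Set.mem_Iio, Set.mem_Ioi, lt_abs]
    constructor
    · rintro (h | h)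
      · exact Or.inr h
      · left; linarith
    · rintro (h | h)
      · right; linarith
      · exact Or.inl h
  rw [hS] at hB ⊢
  have hB1 : IntegrableOn (fun x : ℝ => ‖deriv a x‖ / |x|) (Set.Ioi δ) :=
    hB.mono_set Set.subset_union_right
  have hB2 : IntegrableOn (fun x : ℝ => ‖deriv a x‖ / |x|) (Set.Iio (-δ)) :=
    hB.mono_set Set.subset_union_left
  have hB3 : IntegrableOn (fun x : ℝ => ‖deriv a x‖ / |x|) (Set.Iic (-δ)) :=
    hB2.congr_set_ae Iio_ae_eq_Iic.symm
  have hdisj : Disjoint (Set.Iio (-δ)) (Set.Ioi δ) := by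
    rw [Set.disjoint_left]
    intro x h1 h2
    simp only [Set.mem_Iio, Set.mem_Ioi] at h1 h2
    linarith
  rw [setIntegral_union hdisj measurableSet_Ioi hB2 hB1, setIntegral_congr_set Iio_ae_eq_Iic]
  have hda' : ∀ x, deriv (fun y => a (-y)) x = - deriv a (-x) := fun x => deriv_comp_neg a x
  have right := sp_half C hC φ a t δ ht hδ hδt hφ hφ1 hφ2 ha hai hA hB1
  have left := sp_half C hC (fun x => φ (-x)) (fun x => a (-x)) t δ ht hδ hδt
    (hφ.comp contDiff_neg) (by rw [deriv_comp_neg]; simp [hφ1])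
    (by
      intro x
      have : deriv (fun x => φ (-x)) = fun x => - deriv φ (-x) := by
        ext y; exact deriv_comp_neg φ y
      rw [this, deriv.fun_neg, deriv_comp_neg (deriv φ), neg_neg]
      exact hφ2 (-x))
    (ha.comp contDiff_neg) hai.comp_neg (by simpa using hA.comp_neg)
    (by
      have := (Measure.measurePreserving_neg (volume : Measure ℝ)).integrableOn_comp_preimage
        (Homeomorph.neg ℝ).measurableEmbedding |>.2 hB3
      have h2 : IntegrableOn (fun x => ‖deriv a (-x)‖ / |x|) (Set.Ici δ) := by
        simpa [Function.comp_def] using this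
      simpa [hda'] using h2.mono_set Set.Ioi_subset_Ici_self)
  simp only [hda', norm_neg] at left
  have l1 := integral_comp_neg_Ioi δ
    (fun x => Complex.exp (Complex.I * (t : ℂ) * (φ x : ℂ)) * a x)
  have l2 := integral_comp_neg_Ioi δ (fun x => ‖a x‖ / (t⁻¹ + |x| ^ 2))
  have l3 := integral_comp_neg_Ioi δ (fun x => ‖deriv a x‖ / |x|)
  simp only [abs_neg] at l2 l3
  rw [l1, l2, l3] at left
  have mid : ‖∫ x in Set.Ioc (-δ) δ, Complex.exp (Complex.I * (t : ℂ) * (φ x : ℂ)) * a x‖ ≤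
      (2 * C + 6) * t⁻¹ * ∫ x in Set.Ioc (-δ) δ, ‖a x‖ / (t⁻¹ + |x| ^ 2) := by
    rw [← integral_const_mul]
    refine norm_integral_le_of_norm_le (hA.integrableOn.const_mul _) ?_
    refine (ae_restrict_mem measurableSet_Ioc).mono fun x hx => ?_
    rw [norm_mul, hen, one_mul]
    have hx2 : |x| ^ 2 ≤ t⁻¹ := by
      rw [← hδt]
      have : |x| ≤ δ := abs_le.2 ⟨hx.1.le, hx.2⟩
      gcongr
    rw [mul_div_assoc', le_div_iff₀ (by positivity)]
    have h0 := norm_nonneg (a x)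
    have h1 : t⁻¹ + |x| ^ 2 ≤ (2 * C + 6) * t⁻¹ := by nlinarith
    nlinarith
  have hle : -δ ≤ δ := by linarith
  have split3 : ∀ {E : Type} [NormedAddCommGroup E] [NormedSpace ℝ E] (f : ℝ → E),
      Integrable f → ∫ x, f x = (∫ x in Set.Iic (-δ), f x) + (∫ x in Set.Ioc (-δ) δ, f x) +
        ∫ x in Set.Ioi δ, f x := by
    intro E _ _ f hf
    rw [← setIntegral_union (Set.Iic_disjoint_Ioc le_rfl) measurableSet_Ioc hf.integrableOn
      hf.integrableOn, Set.Iic_union_Ioc_eq_Iic hle,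
      intervalIntegral.integral_Iic_add_Ioi hf.integrableOn hf.integrableOn]
  rw [split3 _ hi, split3 _ hA]
  refine (norm_add₃_le).trans ((add_le_add_three left mid right).trans_eq ?_)
  ring
end

section
/- Let $u_0(\xi)=\sqrt{r(\xi)}$ and $u_1(\xi)=\sqrt{r(\xi)}\int_0^\xi r^{-1}(\eta)\,d\eta$ where $r(\xi)=\frac{1}{\sqrt2}\xi(1-\frac{c_\infty}{\xi}+O(\xi^{-2}))$ with symbol-type errors. Then as $\xi\to\infty$, $u_1(\xi)\int_0^\xi u_0^2(\eta)\,d\eta-u_0(\xi)\int_0^\xi u_1(\eta)u_0(\eta)\,d\eta=\frac{1}{4}2^{-1/4}\xi^{5/2}+O(\xi^{3/2}\log\xi)$, and there exists a constant $c_3$ such that $u_1(\xi)\int_0^\xi u_0u_1(\eta)\,d\eta-u_0(\xi)\int_0^\xi u_1^2(\eta)\,d\eta=\frac{1}{4}2^{1/4}\xi^{5/2}\log\xi+c_3\xi^{5/2}+O(\xi^{3/2}\log\xi)$. -/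
open MeasureTheory intervalIntegral

open Filter Asymptotics Topology in
lemma int_bigO {D D' g g' : ℝ → ℝ} (hD : ∀ᶠ x in atTop, HasDerivAt D (D' x) x)
    (hg : ∀ᶠ x in atTop, HasDerivAt g (g' x) x) (h : D' =O[atTop] g')
    (hg' : ∀ᶠ x in atTop, 0 ≤ g' x) (h1 : (fun _ : ℝ => (1:ℝ)) =O[atTop] g) :
    D =O[atTop] g := by
  obtain ⟨C, hC⟩ := h.bound
  obtain ⟨X, hX⟩ := eventually_atTop.1 (hD.and (hg.and (hC.and hg')))
  have hb : ∀ x ∈ Set.Ici X, |D' x| ≤ C * g' x := by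
    intro x hx
    have := (hX x hx).2.2
    rw [Real.norm_eq_abs, Real.norm_eq_abs, abs_of_nonneg this.2] at this
    exact this.1
  have m1 : MonotoneOn (fun x => C * g x - D x) (Set.Ici X) := by
    apply monotoneOn_of_hasDerivWithinAt_nonneg (f' := fun x => C * g' x - D' x) (convex_Ici X)
    · intro x hx
      exact (((hX x hx).2.1.const_mul C).sub (hX x hx).1).continuousAt.continuousWithinAt
    · intro x hx
      have hx := interior_subset hx
      exact (((hX x hx).2.1.const_mul C).sub (hX x hx).1).hasDerivWithinAt
    · intro x hx
      have := hb x (interior_subset hx)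
      linarith [le_abs_self (D' x)]
  have m2 : MonotoneOn (fun x => C * g x + D x) (Set.Ici X) := by
    apply monotoneOn_of_hasDerivWithinAt_nonneg (f' := fun x => C * g' x + D' x) (convex_Ici X)
    · intro x hx
      exact (((hX x hx).2.1.const_mul C).add (hX x hx).1).continuousAt.continuousWithinAt
    · intro x hx
      have hx := interior_subset hx
      exact (((hX x hx).2.1.const_mul C).add (hX x hx).1).hasDerivWithinAt
    · intro x hx
      have := hb x (interior_subset hx)
      linarith [neg_abs_le (D' x)]
  have e : D =O[atTop] (fun x => C * g x + (|C * g X| + |D X|) * 1) := by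
    apply IsBigO.of_bound 1
    filter_upwards [eventually_ge_atTop X] with x hx
    have a1 := m1 (Set.mem_Ici.2 le_rfl) (Set.mem_Ici.2 hx) hx
    have a2 := m2 (Set.mem_Ici.2 le_rfl) (Set.mem_Ici.2 hx) hx
    simp only at a1 a2
    rw [one_mul, Real.norm_eq_abs, Real.norm_eq_abs]
    refine le_trans ?_ (le_abs_self _)
    rw [abs_le]
    have := neg_abs_le (C * g X)
    have := neg_abs_le (D X)
    have := le_abs_self (D X)
    constructor <;> linarith
  refine e.trans (IsBigO.add ?_ ?_)
  · exact (isBigO_refl g _).const_mul_left C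
  · exact h1.const_mul_left _

open Filter Asymptotics Topology in
lemma int_conv {D D' : ℝ → ℝ} (hD : ∀ᶠ x in atTop, HasDerivAt D (D' x) x)
    (h : D' =O[atTop] (fun x : ℝ => (x^2)⁻¹)) :
    ∃ K, (fun x => D x - K) =O[atTop] (fun x : ℝ => x⁻¹) := by
  obtain ⟨C, hC0, hC'⟩ := h.exists_pos
  have hC := hC'.bound
  obtain ⟨X, hX⟩ := eventually_atTop.1 (hD.and (hC.and (eventually_gt_atTop 0)))
  have hb : ∀ x ∈ Set.Ici X, |D' x| ≤ C * (x^2)⁻¹ := by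
    intro x hx
    have := (hX x hx).2
    rw [Real.norm_eq_abs, Real.norm_eq_abs, abs_of_nonneg (by positivity : 0 ≤ (x^2)⁻¹)] at this
    exact this.1
  have hi : ∀ x ∈ Set.Ici X, HasDerivAt (fun x : ℝ => x⁻¹) (-(x^2)⁻¹) x := fun x hx =>
    hasDerivAt_inv (hX x hx).2.2.ne'
  have m1 : MonotoneOn (fun x => D x - C * x⁻¹) (Set.Ici X) := by
    apply monotoneOn_of_hasDerivWithinAt_nonneg (f' := fun x => D' x - C * -(x^2)⁻¹) (convex_Ici X)
    · intro x hx
      exact ((hX x hx).1.sub ((hi x hx).const_mul C)).continuousAt.continuousWithinAt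
    · intro x hx
      have hx := interior_subset hx
      exact ((hX x hx).1.sub ((hi x hx).const_mul C)).hasDerivWithinAt
    · intro x hx
      have := hb x (interior_subset hx)
      linarith [neg_abs_le (D' x)]
  have m2 : AntitoneOn (fun x => D x + C * x⁻¹) (Set.Ici X) := by
    apply antitoneOn_of_hasDerivWithinAt_nonpos (f' := fun x => D' x + C * -(x^2)⁻¹) (convex_Ici X)
    · intro x hx
      exact ((hX x hx).1.add ((hi x hx).const_mul C)).continuousAt.continuousWithinAt
    · intro x hx
      have hx := interior_subset hx
      exact ((hX x hx).1.add ((hi x hx).const_mul C)).hasDerivWithinAt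
    · intro x hx
      have := hb x (interior_subset hx)
      linarith [le_abs_self (D' x)]
  have key : ∀ x ≥ X, ∀ y ≥ X, D x - C * x⁻¹ ≤ D y + C * y⁻¹ := by
    intro x hx y hy
    have hm : X ≤ max x y := le_max_of_le_left hx
    have a1 := m1 hx hm (le_max_left x y)
    have a2 := m2 hy hm (le_max_right x y)
    simp only at a1 a2
    have : 0 < max x y := (hX _ hm).2.2
    have : 0 < C * (max x y)⁻¹ := by positivity
    linarith
  have hbdd : BddAbove ((fun x => D x - C * x⁻¹) '' Set.Ici X) := by
    refine ⟨D X + C * X⁻¹, ?_⟩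
    rintro _ ⟨x, hx, rfl⟩
    exact key x hx X le_rfl
  refine ⟨sSup ((fun x => D x - C * x⁻¹) '' Set.Ici X), IsBigO.of_bound C ?_⟩
  filter_upwards [eventually_ge_atTop X] with x hx
  have l1 := le_csSup hbdd ⟨x, hx, rfl⟩
  have l2 : sSup ((fun x => D x - C * x⁻¹) '' Set.Ici X) ≤ D x + C * x⁻¹ := by
    apply csSup_le (Set.Nonempty.image _ ⟨X, Set.mem_Ici.2 le_rfl⟩)
    rintro _ ⟨y, hy, rfl⟩
    exact key y hy x hx
  simp only at l1
  have : 0 < x := (hX x hx).2.2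
  rw [Real.norm_eq_abs, Real.norm_eq_abs, abs_of_nonneg (by positivity : 0 ≤ x⁻¹), abs_le]
  constructor <;> linarith

open Filter Asymptotics Topology in
lemma volterra_aux (r : ℝ → ℝ) (hr : Continuous r) (hrpos : ∀ ξ, 0 < r ξ) (a s : ℝ) (ha : 0 < a)
    (has : a * s = 1)
    (h0 : (fun x => r x - a * x) =O[atTop] (fun _ => (1:ℝ))) (L : ℝ → ℝ)
    (hL : ∀ x, L x = ∫ η in (0:ℝ)..x, (r η)⁻¹) :
    ∃ c : ℝ, (fun x => Real.sqrt (r x) * (L x * (∫ η in (0:ℝ)..x, r η) - ∫ η in (0:ℝ)..x, r η * L η)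
        - 1/4 * Real.sqrt a * (x^2 * Real.sqrt x)) =O[atTop] (fun x => x * Real.sqrt x * Real.log x) ∧
      (fun x => Real.sqrt (r x) * (L x * (∫ η in (0:ℝ)..x, r η * L η)
          - ∫ η in (0:ℝ)..x, r η * L η ^ 2)
        - (s * (1/4) * Real.sqrt a * (x^2 * Real.sqrt x) * Real.log x + c * (x^2 * Real.sqrt x)))
        =O[atTop] (fun x => x * Real.sqrt x * Real.log x) := by
  have hs : s = a⁻¹ := by field_simp; linarith
  have hpos : ∀ᶠ x : ℝ in atTop, 0 < x := eventually_gt_atTop 0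
  have hlog1 : (fun _ : ℝ => (1:ℝ)) =O[atTop] Real.log :=
    Real.isLittleO_const_log_atTop.isBigO
  have hx1 : (fun _ : ℝ => (1:ℝ)) =O[atTop] (fun x : ℝ => x) :=
    (isLittleO_const_id_atTop (1:ℝ)).isBigO
  have hxlog1 : (fun _ : ℝ => (1:ℝ)) =O[atTop] (fun x : ℝ => x * Real.log x) := by
    simpa using hx1.mul hlog1
  -- r is comparable to x
  have hlow : ∀ᶠ x : ℝ in atTop, a / 2 * x ≤ r x := by
    obtain ⟨C, hC⟩ := h0.bound
    filter_upwards [hC, eventually_ge_atTop (2 * C / a)] with x hx hx2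
    simp only [Real.norm_eq_abs, abs_one, mul_one] at hx
    rw [div_le_iff₀ ha] at hx2
    linarith [neg_abs_le (r x - a * x)]
  have hrinv : (fun x => (r x)⁻¹) =O[atTop] (fun x : ℝ => x⁻¹) := by
    apply IsBigO.of_bound (a/2)⁻¹
    filter_upwards [hlow, hpos] with x hx hx0
    rw [Real.norm_eq_abs, Real.norm_eq_abs, abs_of_pos (inv_pos.2 (hrpos x)),
      abs_of_pos (inv_pos.2 hx0), ← mul_inv]
    exact inv_anti₀ (by positivity) hx
  have hrinv2 : (fun x => (r x)⁻¹ - s * x⁻¹) =O[atTop] (fun x : ℝ => (x^2)⁻¹) := by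
    have : (fun x => -s * ((r x - a * x) * ((r x)⁻¹ * x⁻¹))) =O[atTop]
        (fun x : ℝ => 1 * (x⁻¹ * x⁻¹)) :=
      (h0.mul (hrinv.mul (isBigO_refl _ _))).const_mul_left _
    refine this.congr' ?_ ?_
    · filter_upwards [hpos] with x hx
      have := (hrpos x).ne'
      rw [hs]; field_simp; ring
    · filter_upwards [hpos] with x hx
      field_simp
  have hrc : Continuous fun x => (r x)⁻¹ := hr.inv₀ fun x => (hrpos x).ne'
  have dL : ∀ x, HasDerivAt L ((r x)⁻¹) x := by
    intro x
    rw [funext hL]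
    exact hrc.integral_hasStrictDerivAt 0 x |>.hasDerivAt
  have hLc : Continuous L := continuous_iff_continuousAt.2 fun x => (dL x).continuousAt
  have dA0 : ∀ x, HasDerivAt (fun x => ∫ η in (0:ℝ)..x, r η) (r x) x := fun x =>
    hr.integral_hasStrictDerivAt 0 x |>.hasDerivAt
  have dA1 : ∀ x, HasDerivAt (fun x => ∫ η in (0:ℝ)..x, r η * L η) (r x * L x) x := fun x =>
    (hr.mul hLc).integral_hasStrictDerivAt 0 x |>.hasDerivAt
  have dA2 : ∀ x, HasDerivAt (fun x => ∫ η in (0:ℝ)..x, r η * L η ^ 2) (r x * L x ^ 2) x := fun x =>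
    (hr.mul (hLc.pow 2)).integral_hasStrictDerivAt 0 x |>.hasDerivAt
  set A0 := fun x => ∫ η in (0:ℝ)..x, r η with hA0
  set A1 := fun x => ∫ η in (0:ℝ)..x, r η * L η with hA1
  set A2 := fun x => ∫ η in (0:ℝ)..x, r η * L η ^ 2 with hA2
  have dlog : ∀ᶠ x : ℝ in atTop, HasDerivAt Real.log x⁻¹ x := by
    filter_upwards [hpos] with x hx using Real.hasDerivAt_log hx.ne'
  obtain ⟨K, hK⟩ : ∃ K, (fun x => L x - s * Real.log x - K) =O[atTop] (fun x : ℝ => x⁻¹) := by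
    apply int_conv (D := fun x => L x - s * Real.log x) _ hrinv2
    filter_upwards [dlog] with x hx
    exact (dL x).sub (hx.const_mul s)
  have hLlog : L =O[atTop] Real.log := by
    have e1 : (fun x : ℝ => x⁻¹) =O[atTop] (fun _ => (1:ℝ)) :=
      (tendsto_inv_atTop_zero).isBigO_one ℝ
    have := ((hK.trans (e1.trans hlog1)).add ((isBigO_refl Real.log atTop).const_mul_left s)).add
      (hlog1.const_mul_left K)
    refine this.congr_left ?_
    intro x; ring
  have dsq : ∀ x : ℝ, HasDerivAt (fun x => x^2) (2 * x) x := fun x => by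
    simpa using hasDerivAt_pow 2 x
  have hA0as : (fun x => A0 x - a / 2 * x^2) =O[atTop] (fun x : ℝ => x) := by
    refine int_bigO (D' := fun x => r x - a / 2 * (2 * x)) (g' := fun _ => 1) ?_ ?_ ?_ ?_ hx1
    · exact Eventually.of_forall fun x => (dA0 x).sub ((dsq x).const_mul _)
    · exact Eventually.of_forall fun x => hasDerivAt_id x
    · exact h0.congr_left fun x => by ring
    · simp
  have hGas : (fun x => L x * A0 x - A1 x - 1/4 * x^2) =O[atTop] (fun x : ℝ => x) := by
    refine int_bigO (D' := fun x => (r x)⁻¹ * A0 x + L x * r x - r x * L x - 1/4 * (2 * x))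
      (g' := fun _ => 1) ?_ ?_ ?_ ?_ hx1
    · exact Eventually.of_forall fun x =>
        (((dL x).mul (dA0 x)).sub (dA1 x)).sub ((dsq x).const_mul _)
    · exact Eventually.of_forall fun x => hasDerivAt_id x
    · have := (hA0as.mul hrinv).add ((((isBigO_refl (fun x : ℝ => x^2) atTop).const_mul_left
        (a/2)).mul hrinv2).congr' (EventuallyEq.refl _ _) (g₂ := fun x : ℝ => x * x⁻¹) (by
          filter_upwards [hpos] with x hx
          field_simp))
      refine this.congr' ?_ ?_
      · filter_upwards [hpos] with x hx
        rw [hs]; field_simp; ring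
      · filter_upwards [hpos] with x hx
        field_simp
    · simp
  have dxlog : ∀ᶠ x : ℝ in atTop, HasDerivAt (fun x => x * Real.log x) (Real.log x + 1) x := by
    filter_upwards [hpos] with x hx using Real.hasDerivAt_mul_log hx.ne'
  have hlogp : ∀ᶠ x : ℝ in atTop, 0 ≤ Real.log x := by
    filter_upwards [eventually_ge_atTop 1] with x hx using Real.log_nonneg hx
  have hlogp1 : ∀ᶠ x : ℝ in atTop, 0 ≤ Real.log x + 1 := by
    filter_upwards [hlogp] with x hx using by linarith
  have hlog2 : Real.log =O[atTop] (fun x => Real.log x + 1) := by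
    apply IsBigO.of_bound 1
    filter_upwards [hlogp] with x hx
    rw [Real.norm_eq_abs, Real.norm_eq_abs, abs_of_nonneg hx, abs_of_nonneg (by linarith)]
    linarith
  have dsqlog : ∀ᶠ x : ℝ in atTop, HasDerivAt (fun x => x^2 * Real.log x)
      (2 * x * Real.log x + x) x := by
    filter_upwards [dlog, hpos] with x hx hx0
    have := (dsq x).mul hx
    refine this.congr_deriv ?_
    field_simp
  have hA1as : (fun x => A1 x - (1/2 * (x^2 * Real.log x) + (a * K / 2 - 1/4) * x^2)) =O[atTop]
      (fun x : ℝ => x * Real.log x) := by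
    refine int_bigO (D' := fun x => r x * L x -
      (1/2 * (2 * x * Real.log x + x) + (a * K / 2 - 1/4) * (2 * x)))
      (g' := fun x => Real.log x + 1) ?_ dxlog ?_ hlogp1 hxlog1
    · filter_upwards [dsqlog] with x hx
      exact (dA1 x).sub ((hx.const_mul _).add ((dsq x).const_mul _))
    · refine IsBigO.trans ?_ hlog2
      have e2 : (fun x => a * x * (L x - s * Real.log x - K)) =O[atTop] Real.log := by
        refine IsBigO.trans ((((isBigO_refl (fun x : ℝ => x) atTop).const_mul_left a).mul hK).congr'
          (EventuallyEq.refl _ _) (g₂ := fun x : ℝ => 1) ?_) hlog1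
        filter_upwards [hpos] with x hx
        field_simp
      have := ((h0.mul hLlog).congr_right (fun x => one_mul (Real.log x))).add e2
      refine this.congr_left fun x => ?_
      linear_combination (-x * Real.log x) * has
  have hsqlog : (fun x : ℝ => x^2) =O[atTop] (fun x => x^2 * Real.log x) := by
    simpa using (isBigO_refl (fun x : ℝ => x^2) atTop).mul hlog1
  have hM1 : (fun x : ℝ => 1/2 * (x^2 * Real.log x) + (a * K / 2 - 1/4) * x^2) =O[atTop]
      (fun x => x^2 * Real.log x) :=
    ((isBigO_refl _ _).const_mul_left _).add (hsqlog.const_mul_left _)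
  have hHas : (fun x => L x * A1 x - A2 x - (s * (1/4) * (x^2 * Real.log x)
      + (K / 4 - s / 4) * x^2)) =O[atTop]
      (fun x : ℝ => x * Real.log x) := by
    refine int_bigO (D' := fun x => (r x)⁻¹ * A1 x + L x * (r x * L x) - r x * L x ^ 2 -
      (s * (1/4) * (2 * x * Real.log x + x) + (K / 4 - s / 4) * (2 * x)))
      (g' := fun x => Real.log x + 1) ?_ dxlog ?_ hlogp1 hxlog1
    · filter_upwards [dsqlog] with x hx
      exact (((dL x).mul (dA1 x)).sub (dA2 x)).sub ((hx.const_mul _).add ((dsq x).const_mul _))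
    · refine IsBigO.trans ?_ hlog2
      have e1 := (hA1as.mul hrinv).congr' (EventuallyEq.refl _ _) (g₂ := Real.log) (by
          filter_upwards [hpos] with x hx
          field_simp)
      have e2 := (hM1.mul hrinv2).congr' (EventuallyEq.refl _ _) (g₂ := Real.log) (by
          filter_upwards [hpos] with x hx
          field_simp)
      refine (e1.add e2).congr' ?_ (EventuallyEq.refl _ _)
      filter_upwards [hpos] with x hx
      rw [hs]; field_simp; ring
  have hsr : (fun x => Real.sqrt (r x) - Real.sqrt a * Real.sqrt x) =O[atTop]
      (fun x : ℝ => Real.sqrt x * x⁻¹) := by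
    obtain ⟨C, hC⟩ := h0.bound
    apply IsBigO.of_bound (C * (Real.sqrt a)⁻¹)
    filter_upwards [hC, hpos] with x hx hx0
    simp only [Real.norm_eq_abs, abs_one, mul_one] at hx
    have h1 : Real.sqrt x * x⁻¹ = (Real.sqrt x)⁻¹ := by
      have := Real.sq_sqrt hx0.le
      have h2 : 0 < Real.sqrt x := Real.sqrt_pos.2 hx0
      field_simp
      exact this
    have hq : 0 < Real.sqrt a * Real.sqrt x := mul_pos (Real.sqrt_pos.2 ha) (Real.sqrt_pos.2 hx0)
    have hp : 0 < Real.sqrt (r x) := Real.sqrt_pos.2 (hrpos x)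
    have h3 : r x - a * x = (Real.sqrt (r x) - Real.sqrt a * Real.sqrt x) *
        (Real.sqrt (r x) + Real.sqrt a * Real.sqrt x) := by
      have b1 := Real.sq_sqrt (hrpos x).le
      have b2 := Real.sq_sqrt hx0.le
      have b3 := Real.sq_sqrt ha.le
      calc r x - a * x = Real.sqrt (r x) ^ 2 - Real.sqrt a ^ 2 * Real.sqrt x ^ 2 := by
            rw [b1, b2, b3]
        _ = _ := by ring
    rw [h3, abs_mul, abs_of_pos (by positivity :
      0 < Real.sqrt (r x) + Real.sqrt a * Real.sqrt x)] at hx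
    rw [h1, Real.norm_eq_abs, Real.norm_eq_abs, abs_of_pos (inv_pos.2 (Real.sqrt_pos.2 hx0)),
      mul_assoc, ← mul_inv, ← div_eq_mul_inv, le_div_iff₀ hq]
    refine le_trans ?_ hx
    gcongr
    linarith
  have hsr2 : (fun x => Real.sqrt (r x)) =O[atTop] (fun x : ℝ => Real.sqrt x) := by
    have e1 : (fun x : ℝ => x⁻¹) =O[atTop] (fun _ => (1:ℝ)) :=
      (tendsto_inv_atTop_zero).isBigO_one ℝ
    have e2 := (isBigO_refl (fun x : ℝ => Real.sqrt x) atTop).mul e1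
    have e3 := (hsr.trans e2).congr_right (fun x => mul_one _)
    refine (e3.add ((isBigO_refl (fun x : ℝ => Real.sqrt x) atTop).const_mul_left
      (Real.sqrt a))).congr_left fun x => ?_
    ring
  have hxxl : (fun x : ℝ => x) =O[atTop] (fun x => x * Real.log x) := by
    simpa using (isBigO_refl (fun x : ℝ => x) atTop).mul hlog1
  refine ⟨(K / 4 - s / 4) * Real.sqrt a, ?_, ?_⟩
  · have e1 := (hsr2.mul (hGas.trans hxxl)).congr_right (g₂ := fun x => x * Real.sqrt x * Real.log x)
      (fun x => by ring)
    have e2 := (hsr.mul (hsqlog.const_mul_left (1/4))).congr' (EventuallyEq.refl _ _)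
      (g₂ := fun x => x * Real.sqrt x * Real.log x) (by
          filter_upwards [hpos] with x hx
          field_simp)
    refine (e1.add e2).congr_left fun x => ?_
    simp only [hA0, hA1]
    ring
  · have e1 := (hsr2.mul hHas).congr_right (g₂ := fun x => x * Real.sqrt x * Real.log x)
      (fun x => by ring)
    have hN : (fun x : ℝ => s * (1/4) * (x^2 * Real.log x) + (K / 4 - s / 4) * x^2) =O[atTop]
      (fun x => x^2 * Real.log x) :=
      ((isBigO_refl _ _).const_mul_left _).add (hsqlog.const_mul_left _)
    have e2 := (hsr.mul hN).congr' (EventuallyEq.refl _ _)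
      (g₂ := fun x => x * Real.sqrt x * Real.log x) (by
          filter_upwards [hpos] with x hx
          field_simp)
    refine (e1.add e2).congr_left fun x => ?_
    simp only [hA1, hA2]
    ring

/-- Asymptotics of the first Volterra iterates built from the zero-energy solutions
`u₀ = √r` and `u₁ = √r ∫_0^ξ r⁻¹` at a conical end: as `ξ → ∞`,
`u₁(ξ)∫_0^ξ u₀² - u₀(ξ)∫_0^ξ u₁u₀ = (1/4) 2^{-1/4} ξ^{5/2} + O(ξ^{3/2} log ξ)` and
`u₁(ξ)∫_0^ξ u₀u₁ - u₀(ξ)∫_0^ξ u₁² = (1/4) 2^{1/4} ξ^{5/2} log ξ + c₃ ξ^{5/2} + O(ξ^{3/2} log ξ)`.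
The key point is the cancellation of the leading `ξ^{5/2} log ξ` term in the first identity. -/
theorem volterra_first_iterates (r : ℝ → ℝ) (hr : Continuous r) (hrpos : ∀ ξ, 0 < r ξ)
    (cinfty C0 x0 : ℝ) (hx0 : 1 ≤ x0)
    (hasym : ∀ ξ : ℝ, x0 ≤ ξ →
      |r ξ - (Real.sqrt 2)⁻¹ * ξ * (1 - cinfty / ξ)| ≤ C0 * ξ ^ (-(1 : ℝ)))
    (u0 u1 : ℝ → ℝ)
    (hu0 : ∀ ξ, u0 ξ = Real.sqrt (r ξ))
    (hu1 : ∀ ξ, u1 ξ = Real.sqrt (r ξ) * ∫ η in (0:ℝ)..ξ, (r η)⁻¹) :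
    ∃ c3 C x1 : ℝ, ∀ ξ : ℝ, x1 ≤ ξ →
      |u1 ξ * (∫ η in (0:ℝ)..ξ, u0 η ^ 2) - u0 ξ * (∫ η in (0:ℝ)..ξ, u1 η * u0 η)
          - (1 / 4) * (2 : ℝ) ^ (-(1 : ℝ) / 4) * ξ ^ ((5 : ℝ) / 2)|
        ≤ C * ξ ^ ((3 : ℝ) / 2) * Real.log ξ
      ∧ |u1 ξ * (∫ η in (0:ℝ)..ξ, u0 η * u1 η) - u0 ξ * (∫ η in (0:ℝ)..ξ, u1 η ^ 2)
          - ((1 / 4) * (2 : ℝ) ^ ((1 : ℝ) / 4) * ξ ^ ((5 : ℝ) / 2) * Real.log ξ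
            + c3 * ξ ^ ((5 : ℝ) / 2))|
        ≤ C * ξ ^ ((3 : ℝ) / 2) * Real.log ξ := by
  have hpos : ∀ᶠ x : ℝ in Filter.atTop, 0 < x := Filter.eventually_gt_atTop 0
  have h2 : (0:ℝ) < Real.sqrt 2 := Real.sqrt_pos.2 two_pos
  have h0 : Asymptotics.IsBigO Filter.atTop (fun x => r x - (Real.sqrt 2)⁻¹ * x)
      (fun _ => (1:ℝ)) := by
    apply Asymptotics.IsBigO.of_bound (|C0| + |(Real.sqrt 2)⁻¹ * cinfty|)
    filter_upwards [Filter.eventually_ge_atTop x0, hpos] with x hx hx0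
    have h := hasym x hx
    have e : r x - (Real.sqrt 2)⁻¹ * x = (r x - (Real.sqrt 2)⁻¹ * x * (1 - cinfty / x))
        - (Real.sqrt 2)⁻¹ * cinfty := by
      field_simp; ring
    rw [Real.norm_eq_abs, norm_one, mul_one, e]
    refine (abs_sub _ _).trans (add_le_add (h.trans ?_) le_rfl)
    rw [Real.rpow_neg_one]
    have i1 : x⁻¹ ≤ 1 := inv_le_one_of_one_le₀ (by linarith)
    have i0 : 0 < x⁻¹ := inv_pos.2 hx0
    calc C0 * x⁻¹ ≤ |C0| * x⁻¹ := by gcongr; exact le_abs_self _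
      _ ≤ |C0| * 1 := by gcongr
      _ = _ := mul_one _
  obtain ⟨c, H1, H2⟩ := volterra_aux r hr hrpos (Real.sqrt 2)⁻¹ (Real.sqrt 2) (inv_pos.2 h2)
    (inv_mul_cancel₀ h2.ne') h0 (fun x => ∫ η in (0:ℝ)..x, (r η)⁻¹) (fun x => rfl)
  obtain ⟨C1, B1⟩ := H1.bound
  obtain ⟨C2, B2⟩ := H2.bound
  obtain ⟨X, hX⟩ := Filter.eventually_atTop.1 (B1.and (B2.and (Filter.eventually_ge_atTop 1)))
  refine ⟨c, max C1 C2, X, fun x hx => ?_⟩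
  obtain ⟨b1, b2, hx1⟩ := hX x hx
  have hx0 : 0 < x := by linarith
  have p3 : x ^ ((3:ℝ)/2) = x * Real.sqrt x := by
    rw [Real.sqrt_eq_rpow, show (3:ℝ)/2 = 1 + 1/2 by norm_num, Real.rpow_add hx0, Real.rpow_one]
  have p5 : x ^ ((5:ℝ)/2) = x^2 * Real.sqrt x := by
    rw [Real.sqrt_eq_rpow, show (5:ℝ)/2 = 2 + 1/2 by norm_num, Real.rpow_add hx0, Real.rpow_two]
  have q1 : (2:ℝ) ^ (-(1:ℝ)/4) = Real.sqrt (Real.sqrt 2)⁻¹ := by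
    rw [Real.sqrt_eq_rpow, Real.sqrt_eq_rpow, ← Real.rpow_neg two_pos.le,
      ← Real.rpow_mul two_pos.le]
    norm_num
  have q2 : (2:ℝ) ^ ((1:ℝ)/4) = Real.sqrt 2 * Real.sqrt (Real.sqrt 2)⁻¹ := by
    rw [← q1, Real.sqrt_eq_rpow, ← Real.rpow_add two_pos]
    norm_num
  have hl : 0 ≤ Real.log x := Real.log_nonneg hx1
  have hg : 0 ≤ x * Real.sqrt x * Real.log x := by positivity
  rw [Real.norm_eq_abs, Real.norm_eq_abs, abs_of_nonneg hg] at b1 b2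
  have f0 : ∀ η, u0 η ^ 2 = r η := fun η => by rw [hu0, Real.sq_sqrt (hrpos η).le]
  have f1 : ∀ η, u1 η * u0 η = r η * ∫ t in (0:ℝ)..η, (r t)⁻¹ := fun η => by
    rw [← f0 η, hu1, ← hu0]; ring
  have f1' : ∀ η, u0 η * u1 η = r η * ∫ t in (0:ℝ)..η, (r t)⁻¹ := fun η => by
    rw [mul_comm, f1]
  have f2 : ∀ η, u1 η ^ 2 = r η * (∫ t in (0:ℝ)..η, (r t)⁻¹) ^ 2 := fun η => by
    rw [← f0 η, hu1, ← hu0]; ring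
  simp only [f0, f1, f1', f2]
  rw [p3, p5, q1, q2, hu0, hu1]
  have m1 := mul_le_mul_of_nonneg_right (le_max_left C1 C2) hg
  have m2 := mul_le_mul_of_nonneg_right (le_max_right C1 C2) hg
  constructor
  · refine le_trans (le_of_eq ?_) ((b1.trans m1).trans (le_of_eq ?_))
    · congr 1; ring
    · ring
  · refine le_trans (le_of_eq ?_) ((b2.trans m2).trans (le_of_eq ?_))
    · congr 1; ring
    · ring
end
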